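/- Let n ≥ 2, let U ⊆ M, and let Y = (Y_1,…,Y_{n−1}) be a partition of M ∖ U among agents 1,…,n−1 such that v_i(Y_i) + m_i(Y_j) ≥ v_i(Y_j) for every pair of distinct i, j ∈ {1,…,n−1} (EFX) and v_i(Y_i) ≥ v_i(U) for every i ∈ {1,…,n−1}. Then for every i ∈ {1,…,n−1}, v_i(Y_i) + (1/n) ∑_{j∈{1,…,n−1}∖{i}} m_i(Y_j) ≥ 1/n; consequently, the allocation X to V_2 = {r, u_1,…,u_{n−1}} defined by X_{u_j} = Y_j and X_r = U has edge (i, u_i) in its PROPavg-graph for each i, and hence satisfies (P1). -/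

import Mathlib

open Finset
open scoped Classical

noncomputable section

variable {G : Type*}

/-- Value of a bundle under an additive valuation. -/
def val (v : G → ℝ) (S : Finset G) : ℝ := ∑ g ∈ S, v g

/-- Minimum value of a good in a bundle; `0` for the empty bundle. -/
def minval (v : G → ℝ) (S : Finset G) : ℝ :=
  if h : S.Nonempty then S.inf' h v else 0

/-- `X` is a partition of the goods into `n` pairwise disjoint (possibly empty) bundles. -/
def IsAlloc {n : ℕ} (X : Fin n → Finset G) : Prop :=
  (∀ i j : Fin n, i ≠ j → Disjoint (X i) (X j)) ∧ (∀ g : G, ∃ i : Fin n, g ∈ X i)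

/-- Agent `i` is PROPavg-satisfied by the allocation `X`. -/
def PROPavgSat {n : ℕ} (v : Fin n → G → ℝ) (X : Fin n → Finset G) (i : Fin n) : Prop :=
  val (v i) (X i) + (1 / ((n : ℝ) - 1)) * ∑ k ∈ Finset.univ.erase i, minval (v i) (X k)
    ≥ 1 / (n : ℝ)

/-- Edge of the PROPavg-graph between agent `i ∈ V₁` and label `u ∈ V₂` (both parts
are indexed by `Fin n`, `r` is the distinguished element of `V₂`). -/
def Edge {n : ℕ} (v : Fin n → G → ℝ) (X : Fin n → Finset G) (r i u : Fin n) : Prop :=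
  val (v i) (X u) + (1 / ((n : ℝ) - 1)) *
      ∑ u' ∈ (Finset.univ.erase r).erase u, minval (v i) (X u')
    ≥ 1 / (n : ℝ)

/-- `i` is one of the agents `1, …, n-1`, i.e. not the last agent. -/
def InV1 {n : ℕ} (i : Fin n) : Prop := (i : ℕ) < n - 1

/-- The set `V₁` of the first `n-1` agents. -/
def V1 (n : ℕ) : Finset (Fin n) := Finset.univ.filter fun i => (i : ℕ) < n - 1

/-- A perfect matching of `V₁` onto `V₂ \ {u}` in the PROPavg-graph `G_X`,
i.e. a bijection from `V₁` to `V₂ \ {u}` all of whose pairs are edges. -/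
def IsPM {n : ℕ} (v : Fin n → G → ℝ) (X : Fin n → Finset G) (r u : Fin n)
    (f : Fin n → Fin n) : Prop :=
  Set.InjOn f {i : Fin n | InV1 i} ∧
  (∀ i : Fin n, InV1 i → f i ≠ u ∧ Edge v X r i (f i)) ∧
  (∀ w : Fin n, w ≠ u → ∃ i : Fin n, InV1 i ∧ f i = w)

/-- Property (P1): `G_X - r` has a perfect matching. -/
def P1 {n : ℕ} (v : Fin n → G → ℝ) (X : Fin n → Finset G) (r : Fin n) : Prop :=
  ∃ f : Fin n → Fin n, IsPM v X r r f

/-- Property (P2): for every `u ∈ V₂`, `G_X - u` has a perfect matching. -/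
def P2 {n : ℕ} (v : Fin n → G → ℝ) (X : Fin n → Finset G) (r : Fin n) : Prop :=
  ∀ u : Fin n, ∃ f : Fin n → Fin n, IsPM v X r u f

/-- The neighborhood `Γ_{G_X}(S) ⊆ V₂` of a set `S ⊆ V₁` in the PROPavg-graph. -/
def Nbr {n : ℕ} (v : Fin n → G → ℝ) (X : Fin n → Finset G) (r : Fin n)
    (S : Finset (Fin n)) : Finset (Fin n) :=
  Finset.univ.filter fun u => ∃ i ∈ S, Edge v X r i u

/-- The allocation obtained from `X` by moving the good `g ∈ X ustar` to `X r`. -/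
def move {n : ℕ} [DecidableEq G] (X : Fin n → Finset G) (r ustar : Fin n) (g : G) :
    Fin n → Finset G :=
  fun u => if u = r then insert g (X r) else if u = ustar then (X ustar).erase g else X u

theorem minval_nonneg {v : G → ℝ} (hv : ∀ g, 0 ≤ v g) (S : Finset G) : 0 ≤ minval v S := by
  unfold minval
  split_ifs with h
  · exact (Finset.le_inf'_iff h v).2 fun g _ => hv g
  · exact le_rfl

theorem mem_V1 {n : ℕ} {i : Fin n} : i ∈ V1 n ↔ InV1 i := by
  simp [V1, InV1]

theorem card_V1 {n : ℕ} (hn : 1 ≤ n) : ((V1 n).card : ℝ) = n - 1 := by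
  have h : (V1 n).card = n - 1 := by
    rw [V1, Fin.card_filter_val_lt]
    omega
  rw [h, Nat.cast_sub hn, Nat.cast_one]

theorem inV1_iff_ne_last {n : ℕ} (h : n - 1 < n) {i : Fin n} :
    InV1 i ↔ i ≠ (⟨n - 1, h⟩ : Fin n) := by
  rw [InV1, Ne, Fin.ext_iff]
  have := i.isLt
  dsimp only
  omega

/-- The charity and the bundles of the agents in `V₁` account for the value of all goods. -/
theorem val_univ_eq_of_partition [Fintype G] {n : ℕ} (v : G → ℝ) (U : Finset G)
    (Y : Fin n → Finset G)
    (hdisj : ∀ i j : Fin n, InV1 i → InV1 j → i ≠ j → Disjoint (Y i) (Y j))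
    (hdisjU : ∀ i : Fin n, InV1 i → Disjoint (Y i) U)
    (hcover : ∀ g : G, g ∉ U → ∃ i : Fin n, InV1 i ∧ g ∈ Y i) :
    val v Finset.univ = ∑ j ∈ V1 n, val v (Y j) + val v U := by
  have hcompl : (Finset.univ : Finset G) = (V1 n).biUnion Y ∪ U := by
    ext g
    by_cases hg : g ∈ U
    · simp [hg]
    · simpa [hg, mem_V1] using hcover g hg
  simp only [_root_.val]
  rw [hcompl, Finset.sum_union, Finset.sum_biUnion]
  · exact fun i hi j hj hij => hdisj i j (mem_V1.1 hi) (mem_V1.1 hj) hij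
  · exact (Finset.disjoint_biUnion_left _ _ _).2 fun i hi => hdisjU i (mem_V1.1 hi)

/-- An agent who is EFX-satisfied and does not envy the charity gets at least `1 / n`, up to
the average of the minimum values of the other bundles. -/
theorem one_div_le_of_efx_of_charity [Fintype G] {n : ℕ} (hn : 2 ≤ n) (v : G → ℝ)
    (hnorm : val v Finset.univ = 1) (U : Finset G) (Y : Fin n → Finset G)
    (hdisj : ∀ i j : Fin n, InV1 i → InV1 j → i ≠ j → Disjoint (Y i) (Y j))
    (hdisjU : ∀ i : Fin n, InV1 i → Disjoint (Y i) U)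
    (hcover : ∀ g : G, g ∉ U → ∃ i : Fin n, InV1 i ∧ g ∈ Y i) {i : Fin n} (hi : InV1 i)
    (hEFX : ∀ j : Fin n, InV1 j → i ≠ j → val v (Y i) + minval v (Y j) ≥ val v (Y j))
    (hU : val v (Y i) ≥ val v U) :
    val v (Y i) + (1 / (n : ℝ)) * ∑ j ∈ (V1 n).erase i, minval v (Y j) ≥ 1 / (n : ℝ) := by
  have hpart := val_univ_eq_of_partition v U Y hdisj hdisjU hcover
  rw [hnorm, ← Finset.add_sum_erase _ _ (mem_V1.2 hi)] at hpart
  have hle : ∑ j ∈ (V1 n).erase i, val v (Y j) ≤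
      ∑ j ∈ (V1 n).erase i, (val v (Y i) + minval v (Y j)) :=
    Finset.sum_le_sum fun j hj =>
      hEFX j (mem_V1.1 (Finset.mem_of_mem_erase hj)) (Finset.ne_of_mem_erase hj).symm
  have hcard := Finset.card_erase_add_one (mem_V1.2 hi)
  have hcard' : (((V1 n).erase i).card : ℝ) = n - 2 := by
    have h : (((V1 n).erase i).card : ℝ) + 1 = n - 1 := by
      rw [← card_V1 (by omega : 1 ≤ n)]
      exact_mod_cast hcard
    linarith
  rw [Finset.sum_add_distrib, Finset.sum_const, nsmul_eq_mul, hcard'] at hle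
  have hn0 : (0 : ℝ) < n := by
    exact_mod_cast (by omega : 0 < n)
  have heq : val v (Y i) + (1 / (n : ℝ)) * ∑ j ∈ (V1 n).erase i, minval v (Y j) =
      (n * val v (Y i) + ∑ j ∈ (V1 n).erase i, minval v (Y j)) / n := by
    field_simp
  rw [heq]
  exact div_le_div_of_nonneg_right (by linarith) hn0.le

/-- an EFX-with-charity allocation for agents `1,…,n-1` yields an
allocation to `V₂` (charity `U` placed at `r`) satisfying (P1), with edge `(i, uᵢ)`
for every `i ∈ V₁`. -/
theorem efx_with_charity_gives_p1 {G : Type*} [Fintype G] (n : ℕ) (hn : 2 ≤ n)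
    (v : Fin n → G → ℝ)
    (hpos : ∀ (i : Fin n) (g : G), 0 ≤ v i g)
    (hnorm : ∀ i : Fin n, val (v i) (Finset.univ : Finset G) = 1)
    (U : Finset G) (Y : Fin n → Finset G)
    (hdisj : ∀ i j : Fin n, InV1 i → InV1 j → i ≠ j → Disjoint (Y i) (Y j))
    (hdisjU : ∀ i : Fin n, InV1 i → Disjoint (Y i) U)
    (hcover : ∀ g : G, g ∉ U → ∃ i : Fin n, InV1 i ∧ g ∈ Y i)
    (hEFX : ∀ i j : Fin n, InV1 i → InV1 j → i ≠ j →
      val (v i) (Y i) + minval (v i) (Y j) ≥ val (v i) (Y j))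
    (hU : ∀ i : Fin n, InV1 i → val (v i) (Y i) ≥ val (v i) U) :
    (∀ i : Fin n, InV1 i →
      val (v i) (Y i) + (1 / (n : ℝ)) * ∑ j ∈ (V1 n).erase i, minval (v i) (Y j)
        ≥ 1 / (n : ℝ)) ∧
    (∀ i : Fin n, InV1 i →
      Edge v (fun u => if u = (⟨n - 1, by omega⟩ : Fin n) then U else Y u)
        (⟨n - 1, by omega⟩ : Fin n) i i) ∧
    P1 v (fun u => if u = (⟨n - 1, by omega⟩ : Fin n) then U else Y u)
      (⟨n - 1, by omega⟩ : Fin n) := by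
  have hprop : ∀ i : Fin n, InV1 i →
      val (v i) (Y i) + (1 / (n : ℝ)) * ∑ j ∈ (V1 n).erase i, minval (v i) (Y j)
        ≥ 1 / (n : ℝ) := fun i hi =>
    one_div_le_of_efx_of_charity hn (v i) (hnorm i) U Y hdisj hdisjU hcover hi
      (fun j hj hij => hEFX i j hi hj hij) (hU i hi)
  have hlast : n - 1 < n := by omega
  have hedge : ∀ i : Fin n, InV1 i →
      Edge v (fun u => if u = (⟨n - 1, hlast⟩ : Fin n) then U else Y u)
        (⟨n - 1, hlast⟩ : Fin n) i i := by
    intro i hi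
    have hV1 : Finset.univ.erase (⟨n - 1, hlast⟩ : Fin n) = V1 n := by
      ext j
      simp [mem_V1, inV1_iff_ne_last hlast]
    have hsum : ∑ j ∈ (V1 n).erase i,
        minval (v i) (if j = (⟨n - 1, hlast⟩ : Fin n) then U else Y j) =
        ∑ j ∈ (V1 n).erase i, minval (v i) (Y j) :=
      Finset.sum_congr rfl fun j hj => by
        rw [if_neg ((inV1_iff_ne_last hlast).1 (mem_V1.1 (Finset.mem_of_mem_erase hj)))]
    unfold Edge
    simp only [hV1, hsum, if_neg ((inV1_iff_ne_last hlast).1 hi)]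
    refine (hprop i hi).trans (add_le_add_right (mul_le_mul_of_nonneg_right ?_
      (Finset.sum_nonneg fun j _ => minval_nonneg (hpos i) (Y j))) _)
    have h2 : (2 : ℝ) ≤ n := by exact_mod_cast hn
    exact one_div_le_one_div_of_le (by linarith) (by linarith)
  exact ⟨hprop, hedge, id, Function.injective_id.injOn,
    fun i hi => ⟨(inV1_iff_ne_last hlast).1 hi, hedge i hi⟩,
    fun w hw => ⟨w, (inV1_iff_ne_last hlast).2 hw, rfl⟩⟩
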